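/- arXiv:2102.05595 — 11 statements merged into one kernel-verified Lean document; each statement's English description precedes it below -/
import Mathlib

section
/- Let (A,⋄,α) be a Hom-Zinbiel algebra over a field K of characteristic 0 and define x·y = x⋄y + y⋄x. Then (A,·,α) is a commutative Hom-associative algebra. Moreover, if in addition α(x⋄y) = α(x)⋄α(y) for all x,y ∈ A, then the linear map L⋄ : A → End(A) defined by L⋄(x)(y) = x⋄y is a representation of the commutative Hom-associative algebra (A,·,α) on A with respect to α. -/
/-- A Hom-Zinbiel algebra gives a commutative Hom-associative algebra via
`x·y = x⋄y + y⋄x`, and (if `α` is multiplicative) left multiplication `L⋄` is a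
representation of this commutative Hom-associative algebra on `A` with respect to `α`. -/
theorem homZinbiel_to_commHomAssoc_and_rep {K A : Type*} [Field K] [CharZero K]
    [AddCommGroup A] [Module K A]
    (d : A →ₗ[K] A →ₗ[K] A) (α : A →ₗ[K] A)
    (hZ : ∀ x y z : A, d (α x) (d y z) = d (d y x) (α z) + d (d x y) (α z)) :
    -- (A, ·, α) is a commutative Hom-associative algebra, where x·y = x⋄y + y⋄x :
    (∀ x y : A, d x y + d y x = d y x + d x y) ∧
    (∀ x y z : A,
      d (α x) (d y z + d z y) + d (d y z + d z y) (α x) =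
        d (d x y + d y x) (α z) + d (α z) (d x y + d y x)) ∧
    -- moreover, if α is multiplicative w.r.t. ⋄, then L⋄ is a representation of (A,·,α):
    ((∀ x y : A, α (d x y) = d (α x) (α y)) →
      (∀ x v : A, d (α x) (α v) = α (d x v)) ∧
      (∀ x y v : A, d (d x y + d y x) (α v) = d (α x) (d y v))) := by
  refine ⟨fun x y => add_comm _ _, fun x y z => ?_, fun hα => ⟨fun x v => (hα x v).symm, ?_⟩⟩
  · simp only [map_add, LinearMap.add_apply, hZ]
    abel
  · intro x y v
    rw [hZ, map_add, LinearMap.add_apply, add_comm]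
end

section
/- Let (A,∗,α) be a Hom-pre-Lie algebra over a field K of characteristic 0 with α bijective and α(x∗y) = α(x)∗α(y) for all x,y ∈ A, let (V;ρ,μ,φ) be a representation of (A,∗,α), and for n ≥ 1 let Cⁿ(A;V) be the space of n-linear maps A^n → V that are alternating in their first n−1 arguments. Define ∂ : Cⁿ(A;V) → Cⁿ⁺¹(A;V) by (∂f)(x₁,…,x_{n+1}) = Σ_{i=1}^{n} (−1)^{i+1} ρ(x_i) f(α⁻¹(x₁),…,α⁻¹(x_i) omitted,…,α⁻¹(x_{n+1})) + Σ_{i=1}^{n} (−1)^{i+1} μ(x_{n+1}) f(α⁻¹(x₁),…,α⁻¹(x_i) omitted,…,α⁻¹(x_n),α⁻¹(x_i)) − Σ_{i=1}^{n} (−1)^{i+1} φ( f(α⁻¹(x₁),…,α⁻¹(x_i) omitted,…,α⁻¹(x_n), α⁻²(x_i)∗α⁻²(x_{n+1})) ) + Σ_{1≤i<j≤n} (−1)^{i+j} φ( f([α⁻²(x_i),α⁻²(x_j)], α⁻¹(x₁),…,α⁻¹(x_i) and α⁻¹(x_j) omitted,…,α⁻¹(x_{n+1})) ), where [a,b] =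 a∗b − b∗a. Then ∂∘∂ = 0. -/
open scoped BigOperators

/-- Representation of a Hom-pre-Lie algebra `(A,∗,α)` on `V` with respect to `φ`. -/
def IsHomPreLieRep {A V : Type*} [AddCommGroup A] [AddCommGroup V]
    (st : A → A → A) (α : A → A) (ρ μ : A → V → V) (φ : V → V) : Prop :=
  (∀ x v, ρ (α x) (φ v) = φ (ρ x v)) ∧
  (∀ x y v, ρ (st x y - st y x) (φ v) = ρ (α x) (ρ y v) - ρ (α y) (ρ x v)) ∧
  (∀ x v, φ (μ x v) = μ (α x) (φ v)) ∧
  (∀ x y v, ρ (α x) (μ y v) - μ (α y) (ρ x v) = μ (st x y) (φ v) - μ (α y) (μ x v))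

/-- The coboundary operator `∂ : Cⁿ(A;V) → Cⁿ⁺¹(A;V)` of a Hom-pre-Lie algebra with
coefficients in a representation `(V;ρ,μ,φ)` (here a cochain with `n+1` arguments is sent
to one with `n+2` arguments; `αinv` denotes `α⁻¹` and `st` the Hom-pre-Lie product). -/
def homPreLieCoboundary {A V : Type*} [AddCommGroup A] [AddCommGroup V]
    (st : A → A → A) (αinv : A → A) (ρ μ : A → V → V) (φ : V → V)
    {n : ℕ} (f : (Fin (n + 1) → A) → V) : (Fin (n + 2) → A) → V :=
  fun x =>
    (∑ i : Fin (n + 1), ((-1 : ℤ) ^ (i : ℕ)) •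
        ρ (x i.castSucc) (f fun j => αinv (x (i.castSucc.succAbove j)))) +
    (∑ i : Fin (n + 1), ((-1 : ℤ) ^ (i : ℕ)) •
        μ (x (Fin.last (n + 1)))
          (f (Fin.snoc (fun j : Fin n => αinv (x (i.succAbove j).castSucc))
              (αinv (x i.castSucc))))) -
    (∑ i : Fin (n + 1), ((-1 : ℤ) ^ (i : ℕ)) •
        φ (f (Fin.snoc (fun j : Fin n => αinv (x (i.succAbove j).castSucc))
              (st (αinv (αinv (x i.castSucc))) (αinv (αinv (x (Fin.last (n + 1))))))))) +
    (∑ i : Fin (n + 1), ∑ j : Fin (n + 1),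
      if i < j then
        ((-1 : ℤ) ^ ((i : ℕ) + (j : ℕ))) •
          φ (f (Fin.cons
              (st (αinv (αinv (x i.castSucc))) (αinv (αinv (x j.castSucc))) -
                st (αinv (αinv (x j.castSucc))) (αinv (αinv (x i.castSucc))))
              (fun l : Fin n => αinv (x (j.castSucc.succAbove (i.succAbove l))))))
      else 0)

namespace HomPreLie

section ListSums

variable {A W W' : Type*} [AddCommGroup W] [AddCommGroup W']

/-- The alternating sum `∑ i, (-1)^i F(x_i)(x_0, …, x̂_i, …)`. -/
def altSum : (A → List A → W) → List A → W
  | _, [] => 0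
  | F, x :: l => F x l - altSum (fun z m => F z (x :: m)) l

/-- The alternating sum `-∑ i < j, (-1)^(i+j) G(x_i)(x_j)(x_0, …, x̂_i, …, x̂_j, …)`. -/
def pairSum : (A → A → List A → W) → List A → W
  | _, [] => 0
  | G, x :: l => altSum (G x) l + pairSum (fun y z m => G y z (x :: m)) l

theorem altSum_cons (F : A → List A → W) (x : A) (l : List A) :
    altSum F (x :: l) = F x l - altSum (fun z m => F z (x :: m)) l := rfl

theorem map_altSum (e : W →+ W') (F : A → List A → W) :
    altSum (fun x m => e (F x m)) = fun l => e (altSum F l) := by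
  funext l
  induction l generalizing F with
  | nil => simp [altSum]
  | cons x l ih => simp only [altSum_cons, ih, map_sub]

theorem map_altSum_linear {R : Type*} [Semiring R] [Module R W] (e : W →ₗ[R] W)
    (F : A → List A → W) : altSum (fun x m => e (F x m)) = fun l => e (altSum F l) :=
  map_altSum e.toAddMonoidHom F

theorem altSum_add (F G : A → List A → W) :
    altSum (fun x m => F x m + G x m) = fun l => altSum F l + altSum G l := by
  funext l
  induction l generalizing F G with
  | nil => simp [altSum]
  | cons x l ih => simp only [altSum_cons, ih]; abel

theorem altSum_neg (F : A → List A → W) :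
    altSum (fun x m => -F x m) = fun l => -altSum F l :=
  map_altSum (-AddMonoidHom.id W) F

theorem altSum_sub (F G : A → List A → W) :
    altSum (fun x m => F x m - G x m) = fun l => altSum F l - altSum G l := by
  simp only [sub_eq_add_neg, altSum_add, altSum_neg]

theorem altSum_nsmul (k : ℕ) (F : A → List A → W) :
    altSum (fun x m => k • F x m) = fun l => k • altSum F l :=
  map_altSum (nsmulAddMonoidHom k) F

theorem altSum_zero : altSum (fun (_ : A) _ => (0 : W)) = fun _ => 0 :=
  map_altSum (0 : W →+ W) fun _ _ => 0

theorem altSum_altSum_cons (G : A → A → List A → W) (w : A) (l : List A) :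
    altSum (fun x => altSum (G x)) (w :: l) =
      altSum (G w) l - altSum (fun z => G z w) l +
        altSum (fun x => altSum fun y m => G x y (w :: m)) l := by
  simp only [altSum_cons, altSum_sub]
  abel

theorem altSum_altSum_swap (G : A → A → List A → W) :
    altSum (fun x => altSum fun y => G y x) = fun l => -altSum (fun x => altSum (G x)) l := by
  funext l
  induction l generalizing G with
  | nil => simp [altSum]
  | cons w l ih => rw [altSum_altSum_cons, altSum_altSum_cons, ih]; abel

theorem altSum₃_rotate (G : A → A → A → List A → W) :
    altSum (fun x => altSum fun y => altSum fun z => G z x y) =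
      altSum (fun x => altSum fun y => altSum fun z => G x y z) := by
  have h₁ (x : A) := altSum_altSum_swap fun y z => G y x z
  have h₂ := altSum_altSum_swap fun x y => altSum fun z => G x y z
  simp only [h₁, h₂, altSum_neg, neg_neg]

theorem altSum₄_swap (G : A → A → A → A → List A → W) :
    altSum (fun x => altSum fun y => altSum fun z => altSum fun w => G z w x y) =
      altSum (fun x => altSum fun y => altSum fun z => altSum fun w => G x y z w) := by
  have h₁ (x : A) := altSum_altSum_swap fun y z => altSum fun w => G y w x z
  have h₂ := altSum_altSum_swap fun x y => altSum fun z => altSum fun w => G x w y z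
  have h₃ (x y : A) := altSum_altSum_swap fun z w => G x z y w
  have h₄ (x : A) := altSum_altSum_swap fun y z => altSum fun w => G x y z w
  funext l
  simp only [h₁, altSum_neg]
  rw [h₂, neg_neg]
  simp only [h₃, altSum_neg]
  simp only [h₄, altSum_neg, neg_neg]

theorem two_nsmul_pairSum (G : A → A → List A → W) (hG : ∀ x y m, G y x m = -G x y m)
    (l : List A) : 2 • pairSum G l = altSum (fun x => altSum (G x)) l := by
  induction l generalizing G with
  | nil => simp [altSum, pairSum]
  | cons w l ih =>
    have h (z : A) : G z w = fun m => -G w z m := funext (hG w z)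
    rw [altSum_altSum_cons, pairSum, smul_add, ih _ fun x y m => hG x y (w :: m)]
    simp only [h, altSum_neg]
    abel

theorem map_pairSum (e : W →+ W') (G : A → A → List A → W) (l : List A) :
    pairSum (fun x y m => e (G x y m)) l = e (pairSum G l) := by
  induction l generalizing G with
  | nil => simp [pairSum]
  | cons x l ih => simp only [pairSum, ih, map_add, map_altSum]

theorem altSum_map {B : Type*} (e : B → A) (F : A → List A → W) (l : List B) :
    altSum F (l.map e) = altSum (fun x m => F (e x) (m.map e)) l := by
  induction l generalizing F with
  | nil => simp [altSum]
  | cons x l ih => simp only [List.map_cons, altSum_cons, ih]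

theorem pairSum_map {B : Type*} (e : B → A) (G : A → A → List A → W) (l : List B) :
    pairSum G (l.map e) = pairSum (fun x y m => G (e x) (e y) (m.map e)) l := by
  induction l generalizing G with
  | nil => simp [pairSum]
  | cons x l ih => simp only [List.map_cons, pairSum, altSum_map, ih]

theorem altSum_ofFn {n : ℕ} (F : A → List A → W) (u : Fin n → A) :
    altSum F (List.ofFn u) =
      ∑ i : Fin n, (-1 : ℤ) ^ (i : ℕ) • F (u i) ((List.ofFn u).eraseIdx i) := by
  induction n generalizing F with
  | zero => simp [altSum]
  | succ n ih =>
    rw [List.ofFn_succ, altSum_cons, ih, Fin.sum_univ_succ, sub_eq_add_neg,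
      ← Finset.sum_neg_distrib]
    simp [pow_succ]

theorem pairSum_ofFn {n : ℕ} (G : A → A → List A → W) (u : Fin n → A) :
    pairSum G (List.ofFn u) =
      -∑ i : Fin n, ∑ j : Fin n, if i < j then
        (-1 : ℤ) ^ ((i : ℕ) + (j : ℕ)) •
          G (u i) (u j) (((List.ofFn u).eraseIdx j).eraseIdx i) else 0 := by
  induction n generalizing G with
  | zero => simp [pairSum]
  | succ n ih =>
    rw [List.ofFn_succ, pairSum, altSum_ofFn, ih, Fin.sum_univ_succ, Fin.sum_univ_succ]
    simp only [Fin.sum_univ_succ (n := n)]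
    simp [pow_succ, pow_add]
    abel

theorem eraseIdx_ofFn {n : ℕ} (u : Fin (n + 1) → A) (i : Fin (n + 1)) :
    (List.ofFn u).eraseIdx i = List.ofFn fun k => u (i.succAbove k) := by
  refine List.ext_getElem (by simp [List.length_eraseIdx, i.is_le]) fun k h₁ h₂ => ?_
  rw [List.getElem_eraseIdx]
  simp only [List.getElem_ofFn]
  split_ifs with h
  · rw [Fin.succAbove_of_castSucc_lt _ _ (by simpa [Fin.lt_def] using h)]; rfl
  · rw [Fin.succAbove_of_le_castSucc _ _ (by simpa [Fin.le_def] using h)]; rfl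

end ListSums

section Differential

variable {K A W : Type*} [Field K] [AddCommGroup A] [Module K A]
  [AddCommGroup W]

/-- The sum `∑ i ≠ j` of `± g([x_i, x_j], …)`, each unordered pair being counted twice. -/
def bracketSum (br : A →ₗ[K] A →ₗ[K] A) (g : List A → W) : List A → W :=
  altSum fun x => altSum fun y m => g (br x y :: m)

variable {br : A →ₗ[K] A →ₗ[K] A} {g : List A → W}

theorem bracketSum_cons (hbr : ∀ x y, br y x = -br x y)
    (hneg : ∀ x l, g (-x :: l) = -g (x :: l))
    (hswap : ∀ x y l, g (y :: x :: l) = -g (x :: y :: l)) (w : A) (l : List A) :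
    bracketSum br g (w :: l) = 2 • altSum (fun z m => g (br w z :: m)) l -
      altSum (fun x => altSum fun y m => g (w :: br x y :: m)) l := by
  rw [bracketSum, altSum_altSum_cons]
  simp only [hswap w (br _ _), hbr w, hneg, altSum_neg]
  abel

/-- The Jacobi identity in cochain form. -/
theorem altSum_jacobi [IsAddTorsionFree W]
    (hjac : ∀ x y z, br (br x y) z + br (br y z) x + br (br z x) y = 0)
    (hadd : ∀ x y l, g ((x + y) :: l) = g (x :: l) + g (y :: l)) :
    altSum (fun x => altSum fun y => altSum fun z m => g (br (br x y) z :: m)) = fun _ => 0 := by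
  have h₀ (m : List A) : g (0 :: m) = 0 := by simpa using hadd 0 0 m
  have h₁ := altSum₃_rotate fun x y z m => g (br (br x y) z :: m)
  have h₂ := altSum₃_rotate fun x y z m => g (br (br z x) y :: m)
  have h₃ : altSum (fun x => altSum fun y => altSum fun z m =>
      g (br (br x y) z :: m) + g (br (br y z) x :: m) + g (br (br z x) y :: m)) = fun _ => 0 := by
    simp only [← hadd, hjac, h₀, altSum_zero]
  simp only [altSum_add] at h₃
  funext l
  have h₄ := congrFun h₃ l
  rw [h₁, h₂, h₁] at h₄
  refine nsmul_right_injective three_ne_zero (M := W) ?_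
  simp only [smul_zero]
  rw [← h₄]
  abel

theorem altSum_bracketSum_bracketSum [IsAddTorsionFree W] (hbr : ∀ x y, br y x = -br x y)
    (hjac : ∀ x y z, br (br x y) z + br (br y z) x + br (br z x) y = 0)
    (hadd : ∀ x y l, g ((x + y) :: l) = g (x :: l) + g (y :: l))
    (hneg : ∀ x l, g (-x :: l) = -g (x :: l))
    (hswap : ∀ x y l, g (y :: x :: l) = -g (x :: y :: l)) :
    bracketSum br (bracketSum br g) = fun _ => 0 := by
  have h := altSum₄_swap fun x y z w m => g (br x y :: br z w :: m)
  rw [bracketSum]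
  simp only [bracketSum_cons hbr hneg hswap, altSum_sub, altSum_nsmul,
    altSum_jacobi hjac hadd, smul_zero, zero_sub]
  funext l
  rw [neg_eq_zero]
  refine self_eq_neg.1 ?_
  conv_lhs => rw [← h]
  have h' (x y z : A) : (fun w m => g (br z w :: br x y :: m)) =
      fun w m => -g (br x y :: br z w :: m) :=
    funext₂ fun w m => hswap _ _ m
  simp only [h', altSum_neg]

variable [Module K W]

/-- The Chevalley–Eilenberg differential attached to a bracket `br`, an action `θ` and a twist
`φ`, on cochains regarded as functions of lists. -/
def differential (br : A →ₗ[K] A →ₗ[K] A) (θ : A →ₗ[K] W →ₗ[K] W) (φ : W →ₗ[K] W)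
    (g : List A → W) (l : List A) : W :=
  altSum (fun x m => θ x (g m)) l - pairSum (fun x y m => φ (g (br x y :: m))) l

variable {θ θ₀ θ₁ : A →ₗ[K] W →ₗ[K] W} {φ : W →ₗ[K] W}

theorem two_nsmul_differential (hbr : ∀ x y, br y x = -br x y)
    (hneg : ∀ x l, g (-x :: l) = -g (x :: l)) (l : List A) :
    2 • differential br θ φ g l =
      2 • altSum (fun x m => θ x (g m)) l - φ (bracketSum br g l) := by
  have h := two_nsmul_pairSum (fun x y m => g (br x y :: m))
    (fun x y m => by rw [hbr x y, hneg]) l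
  have h' := map_pairSum φ.toAddMonoidHom (fun x y m => g (br x y :: m)) l
  simp only [LinearMap.toAddMonoidHom_coe] at h'
  rw [differential, smul_sub, h', bracketSum, ← h, map_nsmul]

theorem differential_neg_cons [IsAddTorsionFree W] (hbr : ∀ x y, br y x = -br x y)
    (hneg : ∀ x l, g (-x :: l) = -g (x :: l))
    (hswap : ∀ x y l, g (y :: x :: l) = -g (x :: y :: l)) (w : A) (l : List A) :
    differential br θ φ g (-w :: l) = -differential br θ φ g (w :: l) := by
  refine nsmul_right_injective two_ne_zero (M := W) ?_
  simp only [smul_neg, two_nsmul_differential hbr hneg, bracketSum_cons hbr hneg hswap,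
    altSum_cons, hneg, map_neg, altSum_neg, LinearMap.neg_apply, map_sub, map_nsmul, smul_sub]
  abel

theorem differential_differential [IsAddTorsionFree W] (hbr : ∀ x y, br y x = -br x y)
    (hjac : ∀ x y z, br (br x y) z + br (br y z) x + br (br z x) y = 0)
    (hadd : ∀ x y l, g ((x + y) :: l) = g (x :: l) + g (y :: l))
    (hswap : ∀ x y l, g (y :: x :: l) = -g (x :: y :: l))
    (hφ : ∀ x w, θ₁ x (φ w) = φ (θ₀ x w))
    (hθ : ∀ x y w, θ₁ x (θ₀ y w) - θ₁ y (θ₀ x w) = θ₁ (br x y) (φ w)) (l : List A) :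
    differential br θ₁ φ (differential br θ₀ φ g) l = 0 := by
  have hneg (x : A) (l : List A) : g (-x :: l) = -g (x :: l) := by
    have h₀ : g (0 :: l) = 0 := by simpa using hadd 0 0 l
    rw [eq_neg_iff_add_eq_zero, ← hadd, neg_add_cancel, h₀]
  have hd (l : List A) := two_nsmul_differential (θ := θ₀) (φ := φ) hbr hneg l
  have hθθ : 2 • altSum (fun x => altSum fun y m => θ₁ x (θ₀ y (g m))) l =
      altSum (fun x => altSum fun y m => φ (θ₀ (br x y) (g m))) l := by
    have h := altSum_altSum_swap fun x y m => θ₁ x (θ₀ y (g m))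
    simp only [← hφ, ← hθ, altSum_sub, h]
    abel
  have hB : bracketSum br (fun l => 2 • differential br θ₀ φ g l) l =
      2 • altSum (fun x => altSum fun y m => θ₀ (br x y) (g m)) l -
      2 • altSum (fun x => altSum fun y => altSum fun z m => θ₀ x (g (br y z :: m))) l := by
    have hrot := altSum₃_rotate fun x y z m => θ₀ x (g (br y z :: m))
    have hBB := altSum_bracketSum_bracketSum hbr hjac hadd hneg hswap
    rw [bracketSum] at hBB ⊢
    simp only [hd, altSum_cons, smul_sub, altSum_sub, altSum_nsmul,
      map_altSum_linear] at hBB hrot ⊢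
    simp only [hBB, hrot]
    simp
  have hB' : bracketSum br (fun l => 2 • differential br θ₀ φ g l) l =
    2 • bracketSum br (differential br θ₀ φ g) l := by
    simp only [bracketSum, altSum_nsmul]
  refine nsmul_right_injective four_ne_zero (M := W) ?_
  have h4 (w : W) : 4 • w = 2 • 2 • w := by rw [smul_smul]; rfl
  simp only [smul_zero, h4]
  rw [two_nsmul_differential hbr (differential_neg_cons hbr hneg hswap), smul_sub,
    ← map_nsmul, ← hB', hB]
  have h₁ : 2 • 2 • altSum (fun x m => θ₁ x (differential br θ₀ φ g m)) l =
      2 • altSum (fun x m => θ₁ x (2 • differential br θ₀ φ g m)) l := by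
    simp only [map_nsmul, altSum_nsmul]
  rw [h₁]
  simp only [hd]
  simp only [map_sub, map_nsmul, altSum_sub, altSum_nsmul, hφ, bracketSum,
    map_altSum_linear] at hθθ ⊢
  rw [hθθ]
  abel

end Differential
section AlternatingMap

variable {K A W : Type*} [Field K] [AddCommGroup A] [Module K A] [AddCommGroup W] [Module K W]
  {n : ℕ}

/-- An alternating map regarded as a function of lists, zero on lists of the wrong length. -/
def listCochain (N : A [⋀^Fin n]→ₗ[K] W) (l : List A) : W :=
  if h : l.length = n then N fun i => l.get (i.cast h.symm) else 0

variable (N : A [⋀^Fin n]→ₗ[K] W)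

theorem listCochain_ofFn (u : Fin n → A) : listCochain N (List.ofFn u) = N u := by
  simp [listCochain]

theorem listCochain_add_cons (x y : A) (l : List A) :
    listCochain N ((x + y) :: l) = listCochain N (x :: l) + listCochain N (y :: l) := by
  by_cases h : l.length + 1 = n
  · subst h
    have key (z : A) : listCochain N (z :: l) = N (Fin.cons z l.get) := by
      rw [← listCochain_ofFn, List.ofFn_succ]
      simp
    simp only [key]
    exact N.toMultilinearMap.cons_add l.get x y
  · simp [listCochain, h]

theorem listCochain_swap (x y : A) (l : List A) :
    listCochain N (y :: x :: l) = -listCochain N (x :: y :: l) := by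
  by_cases h : l.length + 1 + 1 = n
  · subst h
    have key (z w : A) : listCochain N (z :: w :: l) =
        N (Fin.cons z (Fin.cons w l.get : Fin (l.length + 1) → A)) := by
      rw [← listCochain_ofFn, List.ofFn_succ]
      simp
    have h₀₁ : (0 : Fin (l.length + 1 + 1)) ≠ 1 := by simp
    rw [key, key, ← N.map_swap _ h₀₁]
    congr 1
    funext i
    refine Fin.cases ?_ (fun i => Fin.cases ?_ (fun i => ?_) i) i
    · simp
    · simp
    · rw [Function.comp_apply, Equiv.swap_apply_of_ne_of_ne (by simp [Fin.ext_iff])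
        (by simp [Fin.ext_iff])]
      simp
  · simp [listCochain, h]

end AlternatingMap

section HomPreLie

variable {K A V : Type*} [Field K] [AddCommGroup A] [Module K A] [AddCommGroup V] [Module K V]

/-- The action of `A` on `Hom(A, V)`, `(x · F)(y) = ρ(x) F(y) + μ(y) F(x) - φ(F(x · y))`. -/
def homAction (mul : A →ₗ[K] A →ₗ[K] A) (ρ μ : A →ₗ[K] V →ₗ[K] V) (φ : V →ₗ[K] V) :
    A →ₗ[K] (A →ₗ[K] V) →ₗ[K] (A →ₗ[K] V) :=
  LinearMap.mk₂ K (fun x F => ρ x ∘ₗ F + μ.flip (F x) - φ ∘ₗ F ∘ₗ mul x)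
    (fun _ _ _ => by ext; simp; abel) (fun _ _ _ => by ext; simp [smul_sub])
    (fun _ _ _ => by ext; simp; abel) (fun _ _ _ => by ext; simp [smul_sub])

theorem homAction_apply (mul : A →ₗ[K] A →ₗ[K] A) (ρ μ : A →ₗ[K] V →ₗ[K] V) (φ : V →ₗ[K] V)
    (x : A) (F : A →ₗ[K] V) (y : A) :
    homAction mul ρ μ φ x F y = ρ x (F y) + μ y (F x) - φ (F (mul x y)) := rfl

/-- Precomposition of a list cochain with values in `Hom(A, V)` with a linear map. -/
def pullback (e : A →ₗ[K] A) (g : List A → A →ₗ[K] V) (l : List A) : A →ₗ[K] V :=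
  g (l.map e) ∘ₗ e

theorem differential_pullback (mul : A →ₗ[K] A →ₗ[K] A) (ρ μ : A →ₗ[K] V →ₗ[K] V)
    (φ : V →ₗ[K] V) (e : A →ₗ[K] A) (he : ∀ x y, e (mul x y) = mul (e x) (e y))
    (g : List A → A →ₗ[K] V) (l : List A) :
    differential (mul - mul.flip) (homAction mul (ρ ∘ₗ e) (μ ∘ₗ e) φ) (φ.compRight K)
        (pullback e g) l =
      pullback e (differential (mul - mul.flip) (homAction mul ρ μ φ) (φ.compRight K) g) l := by
  have h₁ (F : A → List A → A →ₗ[K] V) :=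
    congrFun (map_altSum (e.lcomp K V).toAddMonoidHom F) l
  have h₂ := map_pairSum (e.lcomp K V).toAddMonoidHom (A := A)
  have h₃ (F : A →ₗ[K] V) : F ∘ₗ e = (e.lcomp K V).toAddMonoidHom F := rfl
  rw [pullback, differential, differential, altSum_map, pairSum_map, h₃, map_sub, ← h₁, ← h₂]
  congr 2
  · funext x m
    ext y
    simp [homAction_apply, pullback, he]
  · funext x y m
    ext z
    simp [pullback, he]

theorem homPreLieCoboundary_eq_differential (st : A →ₗ[K] A →ₗ[K] A) (α : A ≃ₗ[K] A)
    (hα : ∀ x y, α.symm (st x y) = st (α.symm x) (α.symm y))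
    (ρ μ : A →ₗ[K] V →ₗ[K] V) (φ : V →ₗ[K] V) {n : ℕ} (f : (Fin (n + 1) → A) → V)
    (g : List A → A →ₗ[K] V)
    (hg : ∀ (u : Fin n → A) (y : A), g (List.ofFn u) y =
      f (Fin.snoc (fun k => α.symm (u k)) (α.symm y)))
    (x : Fin (n + 2) → A) :
    homPreLieCoboundary (fun a b => st a b) (fun a => α.symm a)
        (fun a v => ρ a v) (fun a v => μ a v) (fun v => φ v) f x =
      differential (st.compr₂ α.symm.toLinearMap - (st.compr₂ α.symm.toLinearMap).flip)
        (homAction (st.compr₂ α.symm.toLinearMap) ρ μ φ) (φ.compRight K) g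
        (List.ofFn fun i => x i.castSucc) (x (Fin.last _)) := by
  have h₁ (i : Fin (n + 1)) : (fun j => α.symm (x (i.castSucc.succAbove j))) =
      Fin.snoc (fun k => α.symm (x (i.succAbove k).castSucc)) (α.symm (x (Fin.last _))) := by
    funext j
    refine Fin.lastCases ?_ (fun j => ?_) j
    · simp
    · simp
  rw [differential, altSum_ofFn, pairSum_ofFn, homPreLieCoboundary]
  simp only [sub_neg_eq_add, LinearMap.add_apply, LinearMap.sum_apply, LinearMap.smul_apply,
    homAction_apply, eraseIdx_ofFn, hg, smul_sub, smul_add, Finset.sum_add_distrib,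
    Finset.sum_sub_distrib, h₁, hα, LinearMap.compr₂_apply, LinearEquiv.coe_coe]
  congr 1
  refine Finset.sum_congr rfl fun i _ => Finset.sum_congr rfl fun j _ => ?_
  split_ifs with hij
  swap
  · simp
  rw [LinearMap.smul_apply]
  congr 1
  cases n with
  | zero => exact absurd hij (by omega)
  | succ m =>
    obtain ⟨i, rfl⟩ : ∃ i' : Fin (m + 1), i = i'.castSucc :=
      ⟨i.castPred (hij.trans_le j.le_last).ne, by simp⟩
    have hl := eraseIdx_ofFn (fun k => x (j.succAbove k).castSucc) i
    have hc (b : A) (w : Fin m → A) :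
        b :: List.ofFn w = List.ofFn (Fin.cons b w : Fin (m + 1) → A) := by
      simp [List.ofFn_succ]
    rw [Fin.val_castSucc, hl, LinearMap.compRight_apply, LinearMap.comp_apply, hc, hg]
    congr 2
    funext k
    refine Fin.lastCases ?_ (fun k => ?_) k
    · simp
    · refine Fin.cases ?_ (fun k => ?_) k
      · simp [hα]
      · rw [Fin.snoc_castSucc]
        simp

theorem isAddTorsionFree [CharZero K] : IsAddTorsionFree V := by
  let := Module.compHom V (algebraMap ℚ K)
  exact .of_module_rat V

end HomPreLie

end HomPreLie

open HomPreLie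

/-- the coboundary operator of a Hom-pre-Lie algebra `(A,∗,α)` (with `α`
bijective and multiplicative) with coefficients in a representation `(V;ρ,μ,φ)`, acting on
cochains (multilinear maps alternating in their first arguments), squares to zero. -/
theorem homPreLieCoboundary_squared {K A V : Type*} [Field K] [CharZero K]
    [AddCommGroup A] [Module K A] [AddCommGroup V] [Module K V]
    (st : A →ₗ[K] A →ₗ[K] A) (α : A ≃ₗ[K] A)
    (hpl : ∀ x y z : A,
      st (st x y) (α z) - st (α x) (st y z) = st (st y x) (α z) - st (α y) (st x z))
    (hα : ∀ x y : A, α (st x y) = st (α x) (α y))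
    (ρ μ : A →ₗ[K] V →ₗ[K] V) (φ : V →ₗ[K] V)
    (hrep : IsHomPreLieRep (fun x y => st x y) (fun x => α x)
      (fun x v => ρ x v) (fun x v => μ x v) (fun v => φ v))
    (n : ℕ) (f : (Fin (n + 1) → A) → V)
    (hf_add : ∀ (i : Fin (n + 1)) (x : Fin (n + 1) → A) (a b : A),
      f (Function.update x i (a + b)) = f (Function.update x i a) + f (Function.update x i b))
    (hf_smul : ∀ (i : Fin (n + 1)) (x : Fin (n + 1) → A) (c : K) (a : A),
      f (Function.update x i (c • a)) = c • f (Function.update x i a))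
    (hf_alt : ∀ (i j : Fin n), i ≠ j → ∀ x : Fin (n + 1) → A,
      x i.castSucc = x j.castSucc → f x = 0) :
    ∀ x : Fin (n + 3) → A,
      homPreLieCoboundary (fun a b => st a b) (fun a => α.symm a)
        (fun a v => ρ a v) (fun a v => μ a v) (fun v => φ v)
        (homPreLieCoboundary (fun a b => st a b) (fun a => α.symm a)
          (fun a v => ρ a v) (fun a v => μ a v) (fun v => φ v) f) x = 0 := by
  obtain ⟨hρφ, hρ, hμφ, hμ⟩ := hrep
  have hα' (x y : A) : α.symm (st x y) = st (α.symm x) (α.symm y) := by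
    rw [α.symm_apply_eq, hα, α.apply_symm_apply, α.apply_symm_apply]
  have : IsAddTorsionFree (A →ₗ[K] V) := isAddTorsionFree (K := K)
  let M : MultilinearMap K (fun _ : Fin (n + 1) => A) V :=
    { toFun := f
      map_update_add' := fun x i a b => by convert hf_add i x a b
      map_update_smul' := fun x i c a => by convert hf_smul i x c a }
  let N : A [⋀^Fin n]→ₗ[K] (A →ₗ[K] V) :=
    { M.curryRight with
      map_eq_zero_of_eq' := fun v i j hv hij => by
        ext y
        exact hf_alt i j hij _ (by simpa using hv) }
  let e : A →ₗ[K] A := α.symm.toLinearMap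
  let mul := st.compr₂ e
  let g := pullback e (listCochain N)
  have hpl' (x y z : A) : mul (mul x y) z - mul x (mul y z) =
      mul (mul y x) z - mul y (mul x z) := by
    simpa [mul, e, hα'] using congrArg (fun a => α.symm (α.symm a)) (hpl x y z)
  have hρφ' (x : A) (v : V) : ρ x (φ v) = φ (ρ (e x) v) := by simpa [e] using hρφ (e x) v
  have hμφ' (x : A) (v : V) : μ x (φ v) = φ (μ (e x) v) := by simpa [e] using (hμφ (e x) v).symm
  have hρ' (x y : A) (v : V) : ρ x (ρ (e y) v) - ρ y (ρ (e x) v) =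
      ρ (mul x y - mul y x) (φ v) := by
    simpa [e, mul, hα'] using (hρ (e x) (e y) v).symm
  have hμ' (x y : A) (v : V) : ρ x (μ (e y) v) - μ y (ρ (e x) v) =
      μ (mul x y) (φ v) - μ y (μ (e x) v) := by
    simpa [e, mul, hα'] using hμ (e x) (e y) v
  have he (x y : A) : e (mul x y) = mul (e x) (e y) := congrArg α.symm (hα' x y)
  have hg (u : Fin n → A) (y : A) : g (List.ofFn u) y =
      f (Fin.snoc (fun k => α.symm (u k)) (α.symm y)) := by
    simp only [g, pullback, List.map_ofFn, listCochain_ofFn, LinearMap.comp_apply]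
    rfl
  have hg' (u : Fin (n + 1) → A) (y : A) :
      differential (mul - mul.flip) (homAction mul (ρ ∘ₗ e) (μ ∘ₗ e) φ) (φ.compRight K)
        (pullback e g) (List.ofFn u) y =
      homPreLieCoboundary (fun a b => st a b) (fun a => α.symm a)
        (fun a v => ρ a v) (fun a v => μ a v) (fun v => φ v) f
        (Fin.snoc (fun k => α.symm (u k)) (α.symm y)) := by
    rw [homPreLieCoboundary_eq_differential st α hα' ρ μ φ f g hg,
      differential_pullback mul ρ μ φ e he, pullback, List.map_ofFn]
    simp only [Fin.snoc_castSucc, Fin.snoc_last]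
    rfl
  intro x
  rw [homPreLieCoboundary_eq_differential st α hα' ρ μ φ _ _ hg']
  have key := differential_differential (br := mul - mul.flip)
    (θ₀ := homAction mul (ρ ∘ₗ e) (μ ∘ₗ e) φ) (θ₁ := homAction mul ρ μ φ)
    (φ := φ.compRight K) (g := pullback e g) (fun x y => by simp) ?_
    (fun x y l => by
      simp [g, pullback, listCochain_add_cons, LinearMap.add_comp])
    (fun x y l => by
      simp [g, pullback, listCochain_swap N (e (e x)), LinearMap.neg_comp]) ?_ ?_
    (List.ofFn fun i => x i.castSucc)
  · exact congrArg (fun F : A →ₗ[K] V => F (x (Fin.last _))) key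
  · intro a b c
    have h₁ := hpl' a b c
    have h₂ := hpl' b c a
    have h₃ := hpl' c a b
    simp only [LinearMap.sub_apply, LinearMap.flip_apply, map_sub]
    linear_combination (norm := abel) h₁ + h₂ + h₃
  · intro a F
    ext b
    simp only [homAction_apply, LinearMap.compRight_apply, LinearMap.comp_apply, hρφ', hμφ',
      map_add, map_sub]
  · intro a b F
    ext c
    have h₁ := hρ' a b (F c)
    have h₂ := hμ' a c (F b)
    have h₃ := hμ' b c (F a)
    have h₄ := congrArg (fun z => φ (φ (F z))) (hpl' a b c)
    simp only [hρφ', hμφ'] at h₁ h₂ h₃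
    simp only [homAction_apply, LinearMap.compRight_apply, LinearMap.comp_apply, hρφ', hμφ',
      map_add, map_sub, LinearMap.sub_apply, LinearMap.flip_apply] at h₁ h₂ h₃ h₄ ⊢
    linear_combination (norm := abel) h₁ + h₂ - h₃ + h₄
end

section
/- Let (A,·,[·,·]) be an F-manifold algebra over a field K of characteristic 0 and let α : A → A be an F-manifold algebra morphism, i.e. a linear map with α(x·y) = α(x)·α(y) and α([x,y]) = [α(x),α(y)] for all x,y ∈ A. Define x ·_α y = α(x)·α(y) and [x,y]_α = [α(x),α(y)]. Then (A, ·_α, [·,·]_α, α) is a Hom-F-manifold algebra. -/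
/-- The Hom-Leibnizator `L(x,y,z) = [α(x), y·z] − [x,y]·α(z) − α(y)·[x,z]`. -/
def homLeib {A : Type*} [AddCommGroup A] (mul br : A → A → A) (α : A → A)
    (x y z : A) : A :=
  br (α x) (mul y z) - mul (br x y) (α z) - mul (α y) (br x z)

/-- `(A, mul, br, α)` is a Hom-F-manifold algebra. -/
def IsHomFManifold {A : Type*} [AddCommGroup A] (mul br : A → A → A) (α : A → A) : Prop :=
  (∀ x y, mul x y = mul y x) ∧
  (∀ x y z, mul (α x) (mul y z) = mul (mul x y) (α z)) ∧
  (∀ x y, br x y = - br y x) ∧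
  (∀ x y z, br (α x) (br y z) + br (α y) (br z x) + br (α z) (br x y) = 0) ∧
  (∀ x y z w, homLeib mul br α (mul x y) (α z) (α w) =
      mul (α (α x)) (homLeib mul br α y z w) + mul (α (α y)) (homLeib mul br α x z w))

/-- Yau twist of an F-manifold algebra along a morphism `α` is a
Hom-F-manifold algebra. -/
theorem fManifold_yau_twist {K A : Type*} [Field K] [CharZero K]
    [AddCommGroup A] [Module K A]
    (mul br : A →ₗ[K] A →ₗ[K] A) (α : A →ₗ[K] A)
    (hcomm : ∀ x y : A, mul x y = mul y x)
    (hassoc : ∀ x y z : A, mul (mul x y) z = mul x (mul y z))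
    (hskew : ∀ x y : A, br x y = - br y x)
    (hjac : ∀ x y z : A, br x (br y z) + br y (br z x) + br z (br x y) = 0)
    (hHM : ∀ x y z w : A,
      homLeib (fun a b => mul a b) (fun a b => br a b) (fun a => a) (mul x y) z w =
        mul x (homLeib (fun a b => mul a b) (fun a b => br a b) (fun a => a) y z w) +
        mul y (homLeib (fun a b => mul a b) (fun a b => br a b) (fun a => a) x z w))
    (hαm : ∀ x y : A, α (mul x y) = mul (α x) (α y))
    (hαb : ∀ x y : A, α (br x y) = br (α x) (α y)) :
    IsHomFManifold (fun x y => mul (α x) (α y)) (fun x y => br (α x) (α y))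
      (fun x => α x) := by
  refine ⟨fun x y => hcomm _ _, fun x y z => ?_, fun x y => hskew _ _, fun x y z => ?_,
    fun x y z w => ?_⟩
  · simp only [hαm, hassoc]
  · simpa only [hαb] using hjac (α (α x)) (α (α y)) (α (α z))
  · simpa only [homLeib, hαm, hαb, map_sub] using
      hHM (α (α (α x))) (α (α (α y))) (α (α (α z))) (α (α (α w)))
end

section
/- Let (A,·,α) be a commutative Hom-associative algebra over a field K of characteristic 0 with a derivation D (i.e. D∘α = α∘D and D(x·y) = D(x)·y + x·D(y) for all x,y ∈ A), and fix λ ∈ K. Define x∗y = x·D(y) + λ x·y. Then (A,·,∗,α) is a Hom-F-manifold admissible algebra; in particular (A,∗,α) is a Hom-pre-Lie algebra. Moreover, when λ = 0, (A,·,∗,α) is a Hom-pre-Lie commutative algebra, i.e. α(x)∗(y·z) − (x∗y)·α(z) − α(y)·(x∗z) = 0 for all x,y,z ∈ A. -/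
/-- `(A, mul, st, α)` is a Hom-F-manifold admissible algebra. -/
def IsHomFAdmissible {A : Type*} [AddCommGroup A] (mul st : A → A → A) (α : A → A) : Prop :=
  (∀ x y, mul x y = mul y x) ∧
  (∀ x y z, mul (α x) (mul y z) = mul (mul x y) (α z)) ∧
  -- (A,∗,α) is Hom-Lie admissible: the commutator bracket satisfies the Hom-Jacobi identity
  (∀ x y z, (st (α x) (st y z - st z y) - st (st y z - st z y) (α x)) +
      (st (α y) (st z x - st x z) - st (st z x - st x z) (α y)) +
      (st (α z) (st x y - st y x) - st (st x y - st y x) (α z)) = 0) ∧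
  -- the compatibility condition
  (∀ x y z, st (α x) (mul y z) - mul (st x y) (α z) - mul (α y) (st x z) =
      st (α y) (mul x z) - mul (st y x) (α z) - mul (α x) (st y z))

/-- a commutative Hom-associative algebra with a derivation `D` gives,
for any fixed `λ`, a Hom-F-manifold admissible algebra via `x∗y = x·D(y) + λ x·y`;
in particular `(A,∗,α)` is Hom-pre-Lie, and for `λ = 0` it is Hom-pre-Lie commutative. -/
theorem derivation_gives_homFAdmissible {K A : Type*} [Field K] [CharZero K]
    [AddCommGroup A] [Module K A]
    (mul : A →ₗ[K] A →ₗ[K] A) (α : A →ₗ[K] A)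
    (hcomm : ∀ x y : A, mul x y = mul y x)
    (hassoc : ∀ x y z : A, mul (α x) (mul y z) = mul (mul x y) (α z))
    (D : A →ₗ[K] A)
    (hDα : ∀ x : A, D (α x) = α (D x))
    (hLeib : ∀ x y : A, D (mul x y) = mul (D x) y + mul x (D y))
    (lam : K)
    (st : A → A → A)
    (hst : ∀ x y : A, st x y = mul x (D y) + lam • mul x y) :
    IsHomFAdmissible (fun x y => mul x y) st (fun x => α x) ∧
    -- (A,∗,α) is a Hom-pre-Lie algebra
    (∀ x y z : A,
      st (st x y) (α z) - st (α x) (st y z) = st (st y x) (α z) - st (α y) (st x z)) ∧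
    -- for λ = 0, (A,·,∗,α) is a Hom-pre-Lie commutative algebra
    (lam = 0 → ∀ x y z : A,
      st (α x) (mul y z) - mul (st x y) (α z) - mul (α y) (st x z) = 0) := by
  -- `T x y z = α(x)·(y·z)` is symmetric in its three arguments.
  obtain ⟨T, hT⟩ : ∃ T : A → A → A → A, ∀ x y z, mul (α x) (mul y z) = T x y z :=
    ⟨_, fun _ _ _ => rfl⟩
  have hT' : ∀ x y z, mul (mul y z) (α x) = T x y z := fun x y z => by rw [hcomm, hT]
  have hswap₂ : ∀ x y z, T x y z = T x z y := fun x y z => by rw [← hT, ← hT, hcomm y z]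
  have hswap₁ : ∀ x y z, T x y z = T y x z := fun x y z => by
    rw [← hT, hassoc, hT', hswap₂, ← hT', ← hassoc, hT]
  have hcompat : ∀ x y z, st (α x) (mul y z) - mul (st x y) (α z) - mul (α y) (st x z) =
      -(lam • T x y z) := fun x y z => by
    simp only [hst, hLeib, map_add, map_smul, LinearMap.add_apply, LinearMap.smul_apply, hT, hT']
    rw [hswap₁ z x (D y), hswap₂ x z (D y), hswap₁ z x y, hswap₂ x z y, hswap₁ y x, hswap₁ y x]
    module
  have hassociator : ∀ x y z, st (st x y) (α z) - st (α x) (st y z) =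
      -(T x y (D (D z)) + lam • T x y (D z)) := fun x y z => by
    simp only [hst, hDα, hLeib, map_add, map_smul, LinearMap.add_apply, LinearMap.smul_apply,
      hT, hT']
    rw [hswap₁ (D z) x (D y), hswap₂ x (D z) (D y), hswap₁ (D z) x y, hswap₂ x (D z) y,
      hswap₁ z x (D y), hswap₂ x z (D y), hswap₁ z x y, hswap₂ x z y]
    module
  refine ⟨⟨hcomm, hassoc, fun x y z => ?_, fun x y z => ?_⟩, fun x y z => ?_, fun h x y z => ?_⟩
  · simp only [hst, hDα, hLeib, map_add, map_sub, map_smul, LinearMap.add_apply,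
      LinearMap.sub_apply, LinearMap.smul_apply, hT, hT', hswap₁, hswap₂]
    module
  · rw [hcompat, hcompat, hswap₁]
  · rw [hassociator, hassociator, hswap₁ x y, hswap₁ x y]
  · rw [hcompat, h, zero_smul, neg_zero]
end

section
/- Let (A,·,[·,·],α) be a Hom-F-manifold algebra over a field K of characteristic 0, let V be a K-vector space with a linear map φ : V → V, let ρ : A → End(V) be a representation of the Hom-Lie algebra (A,[·,·],α) with respect to φ and μ : A → End(V) a representation of the commutative Hom-associative algebra (A,·,α) with respect to φ. Then (V;ρ,μ,φ) is a representation of the Hom-F-manifold algebra A if and only if (A⊕V, ·_μ, [·,·]_ρ, α+φ) is a Hom-F-manifold algebra, where (x₁+v₁)·_μ(x₂+v₂) = x₁·x₂ + μ(x₁)v₂ + μ(x₂)v₁, [x₁+v₁, x₂+v₂]_ρ = [x₁,x₂] + ρ(x₁)v₂ − ρ(x₂)v₁, and (α+φ)(x+v) = α(x)+φ(v) for x₁,x₂,x ∈ A, v₁,v₂,v ∈ V. -/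
/-- `L₁(x,y,u) = ρ(α(x))μ(y)u − μ(α(y))ρ(x)u − μ([x,y])φ(u)`. -/
def repL1 {A V : Type*} [AddCommGroup A] [AddCommGroup V]
    (br : A → A → A) (α : A → A) (ρ μ : A → V → V) (φ : V → V) (x y : A) (u : V) : V :=
  ρ (α x) (μ y u) - μ (α y) (ρ x u) - μ (br x y) (φ u)

/-- `L₂(x,y,u) = μ(α(x))ρ(y)u + μ(α(y))ρ(x)u − ρ(x·y)φ(u)`. -/
def repL2 {A V : Type*} [AddCommGroup A] [AddCommGroup V]
    (mul : A → A → A) (α : A → A) (ρ μ : A → V → V) (φ : V → V) (x y : A) (u : V) : V :=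
  μ (α x) (ρ y u) + μ (α y) (ρ x u) - ρ (mul x y) (φ u)

/-- `(V;ρ,μ,φ)` is a representation of the Hom-F-manifold algebra `(A,mul,br,α)`. -/
def IsHomFManifoldRep {A V : Type*} [AddCommGroup A] [AddCommGroup V]
    (mul br : A → A → A) (α : A → A) (ρ μ : A → V → V) (φ : V → V) : Prop :=
  -- ρ is a representation of the Hom-Lie algebra (A,br,α)
  (∀ x v, ρ (α x) (φ v) = φ (ρ x v)) ∧
  (∀ x y v, ρ (br x y) (φ v) = ρ (α x) (ρ y v) - ρ (α y) (ρ x v)) ∧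
  -- μ is a representation of the commutative Hom-associative algebra (A,mul,α)
  (∀ x v, μ (α x) (φ v) = φ (μ x v)) ∧
  (∀ x y v, μ (mul x y) (φ v) = μ (α x) (μ y v)) ∧
  -- the two compatibility conditions
  (∀ x y z u, repL1 br α ρ μ φ (mul x y) (α z) (φ u) =
      μ (α (α x)) (repL1 br α ρ μ φ y z u) + μ (α (α y)) (repL1 br α ρ μ φ x z u)) ∧
  (∀ x y z u, μ (homLeib mul br α x y z) (φ (φ u)) =
      repL2 mul α ρ μ φ (α y) (α z) (μ x u) - μ (α (α x)) (repL2 mul α ρ μ φ y z u))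

/-- The Hom-Leibnizator of the semidirect product, expressed through `repL1` and `repL2`. -/
theorem homLeib_semidirect {K A V : Type*} [Field K]
    [AddCommGroup A] [Module K A] [AddCommGroup V] [Module K V]
    (mul br : A →ₗ[K] A →ₗ[K] A) (α : A →ₗ[K] A)
    (ρ μ : A →ₗ[K] V →ₗ[K] V) (φ : V →ₗ[K] V) (p q r : A × V) :
    homLeib (fun p q : A × V => (mul p.1 q.1, μ p.1 q.2 + μ q.1 p.2))
        (fun p q : A × V => (br p.1 q.1, ρ p.1 q.2 - ρ q.1 p.2))
        (fun p : A × V => (α p.1, φ p.2)) p q r =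
      (homLeib (fun x y => mul x y) (fun x y => br x y) (fun x => α x) p.1 q.1 r.1,
        repL1 (fun x y => br x y) (fun x => α x) (fun x v => ρ x v) (fun x v => μ x v)
            (fun v => φ v) p.1 q.1 r.2 +
          repL1 (fun x y => br x y) (fun x => α x) (fun x v => ρ x v) (fun x v => μ x v)
            (fun v => φ v) p.1 r.1 q.2 +
          repL2 (fun x y => mul x y) (fun x => α x) (fun x v => ρ x v) (fun x v => μ x v)
            (fun v => φ v) q.1 r.1 p.2) := by
  ext
  · simp [homLeib]
  · simp only [homLeib, repL1, repL2, Prod.snd_sub, map_add, map_sub]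
    abel

theorem repL1_zero {K A V : Type*} [Field K]
    [AddCommGroup A] [Module K A] [AddCommGroup V] [Module K V]
    (br : A →ₗ[K] A →ₗ[K] A) (α : A →ₗ[K] A)
    (ρ μ : A →ₗ[K] V →ₗ[K] V) (φ : V →ₗ[K] V) (x y : A) :
    repL1 (fun x y => br x y) (fun x => α x) (fun x v => ρ x v) (fun x v => μ x v)
      (fun v => φ v) x y 0 = 0 := by
  simp [repL1]

theorem repL2_zero {K A V : Type*} [Field K]
    [AddCommGroup A] [Module K A] [AddCommGroup V] [Module K V]
    (mul : A →ₗ[K] A →ₗ[K] A) (α : A →ₗ[K] A)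
    (ρ μ : A →ₗ[K] V →ₗ[K] V) (φ : V →ₗ[K] V) (x y : A) :
    repL2 (fun x y => mul x y) (fun x => α x) (fun x v => ρ x v) (fun x v => μ x v)
      (fun v => φ v) x y 0 = 0 := by
  simp [repL2]

theorem repL2_add {K A V : Type*} [Field K]
    [AddCommGroup A] [Module K A] [AddCommGroup V] [Module K V]
    (mul : A →ₗ[K] A →ₗ[K] A) (α : A →ₗ[K] A)
    (ρ μ : A →ₗ[K] V →ₗ[K] V) (φ : V →ₗ[K] V) (x y : A) (u v : V) :
    repL2 (fun x y => mul x y) (fun x => α x) (fun x v => ρ x v) (fun x v => μ x v)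
        (fun v => φ v) x y (u + v) =
      repL2 (fun x y => mul x y) (fun x => α x) (fun x v => ρ x v) (fun x v => μ x v)
          (fun v => φ v) x y u +
        repL2 (fun x y => mul x y) (fun x => α x) (fun x v => ρ x v) (fun x v => μ x v)
          (fun v => φ v) x y v := by
  simp only [repL2, map_add]
  abel

/-- `(V;ρ,μ,φ)` is a representation of the Hom-F-manifold algebra `A`
if and only if the semidirect product `A ⊕ V` is a Hom-F-manifold algebra. -/
theorem homFManifold_rep_iff_semidirect {K A V : Type*} [Field K] [CharZero K]
    [AddCommGroup A] [Module K A] [AddCommGroup V] [Module K V]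
    (mul br : A →ₗ[K] A →ₗ[K] A) (α : A →ₗ[K] A)
    (hFM : IsHomFManifold (fun x y => mul x y) (fun x y => br x y) (fun x => α x))
    (ρ μ : A →ₗ[K] V →ₗ[K] V) (φ : V →ₗ[K] V)
    -- ρ is a representation of the Hom-Lie algebra (A,[·,·],α)
    (hρ1 : ∀ (x : A) (v : V), ρ (α x) (φ v) = φ (ρ x v))
    (hρ2 : ∀ (x y : A) (v : V), ρ (br x y) (φ v) = ρ (α x) (ρ y v) - ρ (α y) (ρ x v))
    -- μ is a representation of the commutative Hom-associative algebra (A,·,α)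
    (hμ1 : ∀ (x : A) (v : V), μ (α x) (φ v) = φ (μ x v))
    (hμ2 : ∀ (x y : A) (v : V), μ (mul x y) (φ v) = μ (α x) (μ y v)) :
    IsHomFManifoldRep (fun x y => mul x y) (fun x y => br x y) (fun x => α x)
        (fun x v => ρ x v) (fun x v => μ x v) (fun v => φ v) ↔
      IsHomFManifold
        (fun p q : A × V => (mul p.1 q.1, μ p.1 q.2 + μ q.1 p.2))
        (fun p q : A × V => (br p.1 q.1, ρ p.1 q.2 - ρ q.1 p.2))
        (fun p : A × V => (α p.1, φ p.2)) := by
  obtain ⟨hcomm, hassoc, hskew, hjac, hleib⟩ := hFM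
  constructor
  · rintro ⟨-, -, -, -, h1, h2⟩
    refine ⟨fun p q => ?_, fun p q r => ?_, fun p q => ?_, fun p q r => ?_, fun p q r s => ?_⟩
    · exact Prod.ext (hcomm _ _) (add_comm _ _)
    · refine Prod.ext (hassoc _ _ _) ?_
      have e1 : μ (α p.1) (μ r.1 q.2) = μ (α r.1) (μ p.1 q.2) := by
        rw [← hμ2, ← hμ2, show mul p.1 r.1 = mul r.1 p.1 from hcomm _ _]
      have e2 : μ (mul q.1 r.1) (φ p.2) = μ (α r.1) (μ q.1 p.2) := by
        rw [show mul q.1 r.1 = mul r.1 q.1 from hcomm _ _, hμ2]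
      simp only [map_add, hμ2 p.1 q.1, e1, e2]
      abel
    · exact Prod.ext (hskew _ _) (neg_sub _ _).symm
    · refine Prod.ext (hjac _ _ _) ?_
      simp only [Prod.snd_add, Prod.snd_zero, map_sub, hρ2]
      abel
    · simp only [homLeib_semidirect]
      refine Prod.ext (hleib _ _ _ _) ?_
      have h2a := h2 p.1 r.1 s.1 q.2
      have h2b := h2 q.1 r.1 s.1 p.2
      simp only [Prod.snd_add, map_add, repL2_add, h1] at h2a h2b ⊢
      rw [h2a, h2b]
      abel
  · rintro ⟨-, -, -, -, h⟩
    refine ⟨hρ1, hρ2, hμ1, hμ2, fun x y z u => ?_, fun x y z u => ?_⟩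
    · have h' := congrArg Prod.snd (h (x, 0) (y, 0) (z, 0) (0, u))
      simpa [homLeib_semidirect, repL1_zero, repL2_zero] using h'
    · have h' := congrArg Prod.snd (h (0, u) (x, 0) (y, 0) (z, 0))
      simp only [homLeib_semidirect, repL1_zero, repL2_zero, Prod.snd_add, map_zero, zero_add,
        add_zero, LinearMap.zero_apply] at h'
      rw [eq_sub_iff_add_eq, h']
end

section
/- Let (A,⋄,∗,α) be a Hom-pre-F-manifold algebra over a field K of characteristic 0 and define x·y = x⋄y + y⋄x and [x,y] = x∗y − y∗x. Then (i) (A,·,[·,·],α) is a Hom-F-manifold algebra (the sub-adjacent Hom-F-manifold algebra); and (ii) if in addition α(x⋄y) = α(x)⋄α(y) and α(x∗y) = α(x)∗α(y) for all x,y ∈ A, then the pair (L∗, L⋄), where L∗(x)(y) = x∗y and L⋄(x)(y) = x⋄y, is a representation of the Hom-F-manifold algebra (A,·,[·,·],α) on A with respect to α. -/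
/-- `F₁(x,y,z) = α(x)∗(y⋄z) − α(y)⋄(x∗z) − [x,y]⋄α(z)`. -/
def preF1 {A : Type*} [AddCommGroup A] (d st : A → A → A) (α : A → A) (x y z : A) : A :=
  st (α x) (d y z) - d (α y) (st x z) - d (st x y - st y x) (α z)

/-- `F₂(x,y,z) = α(x)⋄(y∗z) + α(y)⋄(x∗z) − (x·y)∗α(z)`. -/
def preF2 {A : Type*} [AddCommGroup A] (d st : A → A → A) (α : A → A) (x y z : A) : A :=
  d (α x) (st y z) + d (α y) (st x z) - st (d x y + d y x) (α z)

/-- `(A,⋄,∗,α)` is a Hom-pre-F-manifold algebra. -/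
def IsHomPreF {A : Type*} [AddCommGroup A] (d st : A → A → A) (α : A → A) : Prop :=
  -- (A,⋄,α) is a Hom-Zinbiel algebra
  (∀ x y z, d (α x) (d y z) = d (d y x) (α z) + d (d x y) (α z)) ∧
  -- (A,∗,α) is a Hom-pre-Lie algebra
  (∀ x y z, st (st x y) (α z) - st (α x) (st y z) = st (st y x) (α z) - st (α y) (st x z)) ∧
  -- compatibility conditions
  (∀ x y z w, preF1 d st α (d x y + d y x) (α z) (α w) =
      d (α (α x)) (preF1 d st α y z w) + d (α (α y)) (preF1 d st α x z w)) ∧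
  (∀ x y z w,
      d (homLeib (fun a b => d a b + d b a) (fun a b => st a b - st b a) α x y z) (α (α w)) =
        preF2 d st α (α y) (α z) (d x w) - d (α (α x)) (preF2 d st α y z w))

/-- The Hom-Leibnizator of the sub-adjacent operations, in terms of `F₁` and `F₂`. -/
theorem homLeib_subadjacent_eq {K A : Type*} [Field K] [AddCommGroup A] [Module K A]
    (d st : A →ₗ[K] A →ₗ[K] A) (α : A →ₗ[K] A) (x y z : A) :
    homLeib (fun a b => d a b + d b a) (fun a b => st a b - st b a) (fun a => α a) x y z =
      preF1 (fun a b => d a b) (fun a b => st a b) (fun a => α a) x y z +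
      preF1 (fun a b => d a b) (fun a b => st a b) (fun a => α a) x z y +
      preF2 (fun a b => d a b) (fun a b => st a b) (fun a => α a) y z x := by
  simp only [homLeib, preF1, preF2, map_add, map_sub, LinearMap.add_apply, LinearMap.sub_apply]
  abel

theorem preF2_add_right {K A : Type*} [Field K] [AddCommGroup A] [Module K A]
    (d st : A →ₗ[K] A →ₗ[K] A) (α : A →ₗ[K] A) (x y u v : A) :
    preF2 (fun a b => d a b) (fun a b => st a b) (fun a => α a) x y (u + v) =
      preF2 (fun a b => d a b) (fun a b => st a b) (fun a => α a) x y u +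
      preF2 (fun a b => d a b) (fun a b => st a b) (fun a => α a) x y v := by
  simp only [preF2, map_add]
  abel

/-- a Hom-pre-F-manifold algebra gives a sub-adjacent Hom-F-manifold
algebra, and (if α is multiplicative) `(L∗, L⋄)` is a representation of it on `A`. -/
theorem homPreF_subadjacent_and_rep {K A : Type*} [Field K] [CharZero K]
    [AddCommGroup A] [Module K A]
    (d st : A →ₗ[K] A →ₗ[K] A) (α : A →ₗ[K] A)
    (h : IsHomPreF (fun x y => d x y) (fun x y => st x y) (fun x => α x)) :
    IsHomFManifold (fun x y => d x y + d y x) (fun x y => st x y - st y x)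
      (fun x => α x) ∧
    (((∀ x y : A, α (d x y) = d (α x) (α y)) ∧ (∀ x y : A, α (st x y) = st (α x) (α y))) →
      IsHomFManifoldRep (fun x y => d x y + d y x) (fun x y => st x y - st y x)
        (fun x => α x) (fun x v => st x v) (fun x v => d x v) (fun v => α v)) := by
  obtain ⟨hZ, hP, h1, h2⟩ := h
  have hZ' (x y z : A) : d (α x) (d y z) = d (d y x) (α z) + d (d x y) (α z) := hZ x y z
  have hP' (x y z : A) : st (st x y - st y x) (α z) = st (α x) (st y z) - st (α y) (st x z) := by
    rw [map_sub, LinearMap.sub_apply]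
    exact sub_eq_sub_iff_sub_eq_sub.mp (hP x y z)
  refine ⟨⟨fun x y => add_comm _ _, fun x y z => ?_, fun x y => (neg_sub _ _).symm,
    fun x y z => ?_, fun x y z w => ?_⟩, fun ⟨hd, hst⟩ =>
    ⟨fun x v => (hst x v).symm, hP', fun x v => (hd x v).symm, fun x y v => ?_, h1, h2⟩⟩
  · simp only [map_add, LinearMap.add_apply, hZ']
    abel
  · have e1 := hP' x y z
    have e2 := hP' y z x
    have e3 := hP' z x y
    simp only [map_sub (st (α _)), e1, e2, e3]
    abel
  · have e1 := h2 x z w y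
    have e2 := h2 y z w x
    simp only [homLeib_subadjacent_eq, preF2_add_right, h1] at e1 e2 ⊢
    rw [eq_sub_iff_add_eq] at e1 e2
    rw [← e1, ← e2]
    simp only [map_add, LinearMap.add_apply]
    abel
  · simp only [map_add, LinearMap.add_apply, hZ']
    abel
end

section
/- Let (A,·,α) be a commutative Hom-associative algebra over a field K of characteristic 0, let (V;μ,φ) be a representation of (A,·,α), and let T : V → A be an O-operator, i.e. a linear map satisfying T∘φ = α∘T and T(u)·T(v) = T(μ(T(u))v + μ(T(v))u) for all u,v ∈ V. Then (V,⋄,φ) is a Hom-Zinbiel algebra, where u⋄v = μ(T(u))v. -/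
/-- an O-operator `T` on a commutative Hom-associative algebra with respect
to a representation `(V;μ,φ)` induces a Hom-Zinbiel algebra structure `u⋄v = μ(T(u))v`
on `V`. -/
theorem oOperator_gives_homZinbiel {K A V : Type*} [Field K] [CharZero K]
    [AddCommGroup A] [Module K A] [AddCommGroup V] [Module K V]
    (mul : A →ₗ[K] A →ₗ[K] A) (α : A →ₗ[K] A)
    (hcomm : ∀ x y : A, mul x y = mul y x)
    (hassoc : ∀ x y z : A, mul (α x) (mul y z) = mul (mul x y) (α z))
    (μ : A →ₗ[K] V →ₗ[K] V) (φ : V →ₗ[K] V)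
    (hμ1 : ∀ (x : A) (v : V), μ (α x) (φ v) = φ (μ x v))
    (hμ2 : ∀ (x y : A) (v : V), μ (mul x y) (φ v) = μ (α x) (μ y v))
    (T : V →ₗ[K] A)
    (hTφ : ∀ v : V, T (φ v) = α (T v))
    (hT : ∀ u v : V, mul (T u) (T v) = T (μ (T u) v + μ (T v) u)) :
    -- Hom-Zinbiel identity for u⋄v = μ(T(u))v :
    ∀ u v w : V,
      μ (T (φ u)) (μ (T v) w) =
        μ (T (μ (T v) u)) (φ w) + μ (T (μ (T u) v)) (φ w) := by
  intro u v w
  rw [hTφ, ← hμ2, hT, map_add, map_add, LinearMap.add_apply, add_comm]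
end

section
/- Let (A,[·,·],α) be a Hom-Lie algebra over a field K of characteristic 0, let (V;ρ,φ) be a representation of (A,[·,·],α), and let T : V → A be an O-operator, i.e. a linear map satisfying T∘φ = α∘T and [T(u), T(v)] = T(ρ(T(u))v − ρ(T(v))u) for all u,v ∈ V. Then (V,∗,φ) is a Hom-pre-Lie algebra, where u∗v = ρ(T(u))v. -/
/-- an O-operator `T` on a Hom-Lie algebra with respect to a representation
`(V;ρ,φ)` induces a Hom-pre-Lie algebra structure `u∗v = ρ(T(u))v` on `V`. -/
theorem oOperator_gives_homPreLie {K A V : Type*} [Field K] [CharZero K]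
    [AddCommGroup A] [Module K A] [AddCommGroup V] [Module K V]
    (br : A →ₗ[K] A →ₗ[K] A) (α : A →ₗ[K] A)
    (hskew : ∀ x y : A, br x y = - br y x)
    (hjac : ∀ x y z : A, br (α x) (br y z) + br (α y) (br z x) + br (α z) (br x y) = 0)
    (ρ : A →ₗ[K] V →ₗ[K] V) (φ : V →ₗ[K] V)
    (hρ1 : ∀ (x : A) (v : V), ρ (α x) (φ v) = φ (ρ x v))
    (hρ2 : ∀ (x y : A) (v : V), ρ (br x y) (φ v) = ρ (α x) (ρ y v) - ρ (α y) (ρ x v))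
    (T : V →ₗ[K] A)
    (hTφ : ∀ v : V, T (φ v) = α (T v))
    (hT : ∀ u v : V, br (T u) (T v) = T (ρ (T u) v - ρ (T v) u)) :
    -- Hom-pre-Lie identity for u∗v = ρ(T(u))v :
    ∀ u v w : V,
      ρ (T (ρ (T u) v)) (φ w) - ρ (T (φ u)) (ρ (T v) w) =
        ρ (T (ρ (T v) u)) (φ w) - ρ (T (φ v)) (ρ (T u) w) := by
  intro u v w
  have h := hρ2 (T u) (T v) w
  rw [hT, map_sub, map_sub, LinearMap.sub_apply, ← hTφ, ← hTφ] at h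
  rw [sub_eq_sub_iff_sub_eq_sub]
  exact h
end

section
/- Let (A,·,[·,·],α) be a Hom-F-manifold algebra over a field K of characteristic 0, let (V;ρ,μ,φ) be a representation of A, and let T : V → A be an O-operator on A, i.e. a linear map satisfying T∘φ = α∘T, T(u)·T(v) = T(μ(T(u))v + μ(T(v))u), and [T(u), T(v)] = T(ρ(T(u))v − ρ(T(v))u) for all u,v ∈ V. Define u⋄v = μ(T(u))v and u∗v = ρ(T(u))v. Then (V,⋄,∗,φ) is a Hom-pre-F-manifold algebra, and T is a homomorphism from its sub-adjacent Hom-F-manifold algebra to (A,·,[·,·],α): T(u⋄v + v⋄u) = T(u)·T(v) and T(u∗v − v∗u) = [T(u), T(v)] for all u,v ∈ V. -/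
/-- an O-operator `T` on a Hom-F-manifold algebra with respect to a
representation `(V;ρ,μ,φ)` induces a Hom-pre-F-manifold algebra structure on `V`
(`u⋄v = μ(T(u))v`, `u∗v = ρ(T(u))v`), and `T` is a homomorphism from the sub-adjacent
Hom-F-manifold algebra to `A`. -/
theorem oOperator_gives_homPreF {K A V : Type*} [Field K] [CharZero K]
    [AddCommGroup A] [Module K A] [AddCommGroup V] [Module K V]
    (mul br : A →ₗ[K] A →ₗ[K] A) (α : A →ₗ[K] A)
    (hFM : IsHomFManifold (fun x y => mul x y) (fun x y => br x y) (fun x => α x))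
    (ρ μ : A →ₗ[K] V →ₗ[K] V) (φ : V →ₗ[K] V)
    (hrep : IsHomFManifoldRep (fun x y => mul x y) (fun x y => br x y) (fun x => α x)
      (fun x v => ρ x v) (fun x v => μ x v) (fun v => φ v))
    (T : V →ₗ[K] A)
    (hTφ : ∀ v : V, T (φ v) = α (T v))
    (hTmul : ∀ u v : V, mul (T u) (T v) = T (μ (T u) v + μ (T v) u))
    (hTbr : ∀ u v : V, br (T u) (T v) = T (ρ (T u) v - ρ (T v) u)) :
    IsHomPreF (fun u v => μ (T u) v) (fun u v => ρ (T u) v) (fun v => φ v) ∧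
    -- T is a homomorphism from the sub-adjacent Hom-F-manifold algebra to A
    (∀ u v : V, T (μ (T u) v + μ (T v) u) = mul (T u) (T v)) ∧
    (∀ u v : V, T (ρ (T u) v - ρ (T v) u) = br (T u) (T v)) := by
  obtain ⟨-, hρbr, -, hμmul, hL1, hL2⟩ := hrep
  have hM : ∀ u v : V, T (μ (T u) v + μ (T v) u) = mul (T u) (T v) := fun u v => (hTmul u v).symm
  have hB : ∀ u v : V, T (ρ (T u) v - ρ (T v) u) = br (T u) (T v) := fun u v => (hTbr u v).symm
  have hF1 : ∀ x y z : V, preF1 (fun u v => μ (T u) v) (fun u v => ρ (T u) v) (fun v => φ v) x y z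
      = repL1 (fun x y => br x y) (fun x => α x) (fun x v => ρ x v) (fun x v => μ x v)
          (fun v => φ v) (T x) (T y) z := by
    intro x y z
    simp only [preF1, repL1, hTφ, hB]
  have hF2 : ∀ x y z : V, preF2 (fun u v => μ (T u) v) (fun u v => ρ (T u) v) (fun v => φ v) x y z
      = repL2 (fun x y => mul x y) (fun x => α x) (fun x v => ρ x v) (fun x v => μ x v)
          (fun v => φ v) (T x) (T y) z := by
    intro x y z
    simp only [preF2, repL2, hTφ, hM]
  have hLeib : ∀ x y z : V, T (homLeib (fun a b => μ (T a) b + μ (T b) a)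
        (fun a b => ρ (T a) b - ρ (T b) a) (fun v => φ v) x y z)
      = homLeib (fun x y => mul x y) (fun x y => br x y) (fun x => α x) (T x) (T y) (T z) := by
    intro x y z
    simp only [homLeib]
    rw [map_sub T, map_sub T, hB, hM, hM, hM, hB, hB, hTφ, hTφ, hTφ]
  refine ⟨⟨fun x y z => ?_, fun x y z => ?_, fun x y z w => ?_, fun x y z w => ?_⟩, hM, hB⟩
  · have h := hμmul (T x) (T y) z
    simp only [← hM, map_add, LinearMap.add_apply] at h
    simp only [hTφ]
    rw [← h, add_comm]
  · have h := hρbr (T x) (T y) z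
    simp only [← hB, map_sub, LinearMap.sub_apply] at h
    simp only [hTφ]
    rw [sub_eq_sub_iff_sub_eq_sub, h]
  · simp only [hF1, hTφ, hM]
    exact hL1 (T x) (T y) (T z) w
  · simp only [hF2, hTφ, hLeib]
    exact hL2 (T x) (T y) (T z) w
end

section
/- Let (A,·,[·,·],α) be a Hom-F-manifold algebra over a field K of characteristic 0 with α(x·y) = α(x)·α(y) and α([x,y]) = [α(x),α(y)] for all x,y ∈ A, and let R : A → A be a Rota-Baxter operator of weight zero, i.e. a linear map satisfying R∘α = α∘R, R(x)·R(y) = R(R(x)·y + x·R(y)), and [R(x), R(y)] = R([R(x), y] + [x, R(y)]) for all x,y ∈ A. Define x⋄y = R(x)·y and x∗y = [R(x), y]. Then (A,⋄,∗,α) is a Hom-pre-F-manifold algebra, and R is a homomorphism from the sub-adjacent Hom-F-manifold algebra (A, ·_R, [·,·]_R, α) to (A,·,[·,·],α), where x·_R y = x⋄y + y⋄x and [x,y]_R = x∗y − y∗x; that is, R(x·_R y) = R(x)·R(y) and R([x,y]_R) = [R(x), R(y)]. -/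
/-- a Rota-Baxter operator `R` of weight zero on a Hom-F-manifold algebra
(whose twist `α` is multiplicative) induces a Hom-pre-F-manifold algebra structure
`x⋄y = R(x)·y`, `x∗y = [R(x),y]`, and `R` is a homomorphism from the sub-adjacent
Hom-F-manifold algebra to `(A,·,[·,·],α)`. -/
theorem rotaBaxter_gives_homPreF {K A : Type*} [Field K] [CharZero K]
    [AddCommGroup A] [Module K A]
    (mul br : A →ₗ[K] A →ₗ[K] A) (α : A →ₗ[K] A)
    (hFM : IsHomFManifold (fun x y => mul x y) (fun x y => br x y) (fun x => α x))
    (hαm : ∀ x y : A, α (mul x y) = mul (α x) (α y))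
    (hαb : ∀ x y : A, α (br x y) = br (α x) (α y))
    (R : A →ₗ[K] A)
    (hRα : ∀ x : A, R (α x) = α (R x))
    (hRmul : ∀ x y : A, mul (R x) (R y) = R (mul (R x) y + mul x (R y)))
    (hRbr : ∀ x y : A, br (R x) (R y) = R (br (R x) y + br x (R y))) :
    IsHomPreF (fun x y => mul (R x) y) (fun x y => br (R x) y) (fun x => α x) ∧
    -- R is a homomorphism from the sub-adjacent Hom-F-manifold algebra to (A,·,[·,·],α)
    (∀ x y : A, R (mul (R x) y + mul (R y) x) = mul (R x) (R y)) ∧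
    (∀ x y : A, R (br (R x) y - br (R y) x) = br (R x) (R y)) := by
  obtain ⟨hcomm, hassoc, hskew, hjac, hleib⟩ := hFM
  beta_reduce at hcomm hassoc hskew hjac hleib
  have homMul : ∀ x y : A, R (mul (R x) y + mul (R y) x) = mul (R x) (R y) := by
    intro x y
    rw [hRmul x y, hcomm x (R y)]
  have homBr : ∀ x y : A, R (br (R x) y - br (R y) x) = br (R x) (R y) := by
    intro x y
    rw [hRbr x y, hskew x (R y), sub_eq_add_neg]
  -- `F₁` and `F₂` are the Hom-Leibnizator evaluated through `R`.
  have F1_eq : ∀ x y z : A,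
      preF1 (fun x y => mul (R x) y) (fun x y => br (R x) y) (fun x => α x) x y z =
        homLeib (fun x y => mul x y) (fun x y => br x y) (fun x => α x) (R x) (R y) z := by
    intro x y z
    simp only [preF1, homLeib, homBr, hRα]
    abel
  have F2_eq : ∀ x y z : A,
      preF2 (fun x y => mul (R x) y) (fun x y => br (R x) y) (fun x => α x) x y z =
        homLeib (fun x y => mul x y) (fun x y => br x y) (fun x => α x) z (R x) (R y) := by
    intro x y z
    simp only [preF2, homLeib, homMul, hRα]
    rw [hskew (α z), hskew z (R x), hskew z (R y), hcomm (-br (R x) z)]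
    simp only [map_neg]
    abel
  have homLeib_eq : ∀ x y z : A,
      R (homLeib (fun a b => mul (R a) b + mul (R b) a) (fun a b => br (R a) b - br (R b) a)
          (fun x => α x) x y z) =
        homLeib (fun x y => mul x y) (fun x y => br x y) (fun x => α x) (R x) (R y) (R z) := by
    intro x y z
    simp only [homLeib]
    rw [map_sub, map_sub, homBr, homMul, homMul, homMul, homBr, homBr, hRα, hRα, hRα]
  refine ⟨⟨?_, ?_, ?_, ?_⟩, homMul, homBr⟩
  · intro x y z
    simp only [hRα]
    rw [hassoc, ← LinearMap.add_apply, ← map_add, ← map_add, add_comm (mul (R y) x), homMul]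
  · intro x y z
    have hj := hjac (R x) (R y) z
    have hb : br (R (br (R x) y)) (α z) - br (R (br (R y) x)) (α z) =
        br (br (R x) (R y)) (α z) := by
      rw [← LinearMap.sub_apply, ← map_sub, ← map_sub, homBr]
    simp only [hRα] at hj ⊢
    rw [hskew z (R x), hskew (α z), map_neg, ← hb] at hj
    rw [← sub_eq_zero, ← neg_eq_zero, ← hj]
    abel
  · intro x y z w
    simp only [F1_eq, homMul, hRα]
    exact hleib (R x) (R y) (R z) w
  · intro x y z w
    simp only [F2_eq, homLeib_eq, hRα]
    have h := hleib (R x) w (R y) (R z)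
    rw [hcomm (α (α w))] at h
    exact (sub_eq_of_eq_add' h).symm
end

section
/- Let (A,·,[·,·],α) be a Hom-F-manifold algebra over a field K of characteristic 0. There exist bilinear products ⋄ and ∗ on A such that (A,⋄,∗,α) is a Hom-pre-F-manifold algebra with α(x⋄y) = α(x)⋄α(y) and α(x∗y) = α(x)∗α(y) for all x,y, whose sub-adjacent Hom-F-manifold algebra is exactly (A,·,[·,·],α) (i.e. x·y = x⋄y + y⋄x and [x,y] = x∗y − y∗x), if and only if there exist a K-vector space V, a representation (V;ρ,μ,φ) of the Hom-F-manifold algebra A, and an invertible O-operator T : V → A on A with respect to (V;ρ,μ,φ). -/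
universe u

/-- A Hom-pre-F-manifold structure splitting `mul` and `br` whose products commute with `α` acts
on `A` by left multiplications, and this is a representation. -/
theorem IsHomPreF.isHomFManifoldRep {A : Type*} [AddCommGroup A] {d st mul br : A → A → A}
    {α : A → A} (h : IsHomPreF d st α) (hd : ∀ x y, α (d x y) = d (α x) (α y))
    (hst : ∀ x y, α (st x y) = st (α x) (α y)) (hmul : ∀ x y, mul x y = d x y + d y x)
    (hbr : ∀ x y, br x y = st x y - st y x)
    (hst_sub : ∀ x y z, st (x - y) z = st x z - st y z)
    (hd_add : ∀ x y z, d (x + y) z = d x z + d y z) :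
    IsHomFManifoldRep mul br α st d α := by
  obtain rfl : mul = fun x y => d x y + d y x := funext₂ hmul
  obtain rfl : br = fun x y => st x y - st y x := funext₂ hbr
  obtain ⟨hZinbiel, hpreLie, hF₁, hF₂⟩ := h
  refine ⟨fun x v => (hst x v).symm, fun x y v => ?_, fun x v => (hd x v).symm,
    fun x y v => ?_, hF₁, hF₂⟩
  · have := hpreLie x y v
    rw [hst_sub]
    grind
  · rw [hZinbiel, hd_add, add_comm]

/-- A representation on `V` together with a bijection `T : V → A` intertwining the actions with
products `d` and `st` that split `mul` and `br` makes `A` a Hom-pre-F-manifold algebra. -/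
theorem IsHomFManifoldRep.isHomPreF {A V : Type*} [AddCommGroup A] [AddCommGroup V]
    {mul br d st : A → A → A} {α : A → A} {ρ μ : A → V → V} {φ : V → V}
    (h : IsHomFManifoldRep mul br α ρ μ φ) (T : V ≃+ A) (hφ : ∀ v, α (T v) = T (φ v))
    (hd : ∀ x v, d x (T v) = T (μ x v)) (hst : ∀ x v, st x (T v) = T (ρ x v))
    (hmul : ∀ x y, mul x y = d x y + d y x) (hbr : ∀ x y, br x y = st x y - st y x)
    (hst_sub : ∀ x y z, st (x - y) z = st x z - st y z)
    (hd_add : ∀ x y z, d (x + y) z = d x z + d y z) :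
    IsHomPreF d st α := by
  obtain rfl : mul = fun x y => d x y + d y x := funext₂ hmul
  obtain rfl : br = fun x y => st x y - st y x := funext₂ hbr
  obtain ⟨-, hρ, -, hμ, hL₁, hL₂⟩ := h
  have hF₁ (x y : A) (u : V) : preF1 d st α x y (T u) =
      T (repL1 (fun x y => st x y - st y x) α ρ μ φ x y u) := by
    simp only [preF1, repL1, hd, hst, hφ, map_sub]
  have hF₂ (x y : A) (u : V) : preF2 d st α x y (T u) =
      T (repL2 (fun x y => d x y + d y x) α ρ μ φ x y u) := by
    simp only [preF2, repL2, hd, hst, hφ, map_add, map_sub]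
  refine ⟨fun x y z => ?_, fun x y z => ?_, fun x y z w => ?_, fun x y z w => ?_⟩
  · obtain ⟨v, rfl⟩ := T.surjective z
    rw [add_comm, ← hd_add, hφ, hd, hd, hd, ← hμ]
  · obtain ⟨v, rfl⟩ := T.surjective z
    have := congrArg T (hρ x y v)
    rw [map_sub, ← hst, ← hφ, hst_sub, ← hst, ← hst, ← hst, ← hst] at this
    grind
  · obtain ⟨u, rfl⟩ := T.surjective w
    simp only [hφ, hF₁, hd, ← map_add]
    exact congrArg T (hL₁ x y z u)
  · obtain ⟨u, rfl⟩ := T.surjective w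
    simp only [hφ, hd, hF₂, ← map_sub]
    exact congrArg T (hL₂ x y z u)

/-- a Hom-F-manifold algebra admits a compatible Hom-pre-F-manifold
algebra structure (with multiplicative twist) if and only if there exists an invertible
O-operator on it with respect to some representation. -/
theorem homFManifold_compatible_preF_iff_invertible_oOperator
    {K : Type*} {A : Type u} [Field K] [CharZero K] [AddCommGroup A] [Module K A]
    (mul br : A →ₗ[K] A →ₗ[K] A) (α : A →ₗ[K] A)
    (hFM : IsHomFManifold (fun x y => mul x y) (fun x y => br x y) (fun x => α x)) :
    (∃ d st : A →ₗ[K] A →ₗ[K] A,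
        IsHomPreF (fun x y => d x y) (fun x y => st x y) (fun x => α x) ∧
        (∀ x y : A, α (d x y) = d (α x) (α y)) ∧
        (∀ x y : A, α (st x y) = st (α x) (α y)) ∧
        (∀ x y : A, mul x y = d x y + d y x) ∧
        (∀ x y : A, br x y = st x y - st y x)) ↔
      (∃ (V : ModuleCat.{u} K) (ρ μ : A →ₗ[K] V →ₗ[K] V) (φ : V →ₗ[K] V) (T : V →ₗ[K] A),
        IsHomFManifoldRep (fun x y => mul x y) (fun x y => br x y) (fun x => α x)
          (fun x v => ρ x v) (fun x v => μ x v) (fun v => φ v) ∧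
        (∀ v : V, T (φ v) = α (T v)) ∧
        (∀ u v : V, mul (T u) (T v) = T (μ (T u) v + μ (T v) u)) ∧
        (∀ u v : V, br (T u) (T v) = T (ρ (T u) v - ρ (T v) u)) ∧
        Function.Bijective T) := by
  constructor
  · rintro ⟨d, st, h, hd, hst, hmul, hbr⟩
    exact ⟨ModuleCat.of K A, st, d, α, LinearMap.id,
      h.isHomFManifoldRep hd hst hmul hbr (by simp) (by simp),
      fun _ => rfl, hmul, hbr, Function.bijective_id⟩
  · rintro ⟨V, ρ, μ, φ, T, h, hφ, hmul, hbr, hT⟩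
    let e : V ≃ₗ[K] A := LinearEquiv.ofBijective T hT
    let transport (σ : A →ₗ[K] V →ₗ[K] V) : A →ₗ[K] A →ₗ[K] A :=
      (σ.compl₂ e.symm.toLinearMap).compr₂ T
    have htransport (σ : A →ₗ[K] V →ₗ[K] V) (x : A) (v : V) :
        transport σ x (T v) = T (σ x v) :=
      congrArg (fun w => T (σ x w)) (e.symm_apply_apply v)
    have hsplit_mul (x y : A) : mul x y = transport μ x y + transport μ y x := by
      obtain ⟨u, rfl⟩ := hT.surjective x
      obtain ⟨v, rfl⟩ := hT.surjective y
      rw [hmul, htransport, htransport, map_add]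
    have hsplit_br (x y : A) : br x y = transport ρ x y - transport ρ y x := by
      obtain ⟨u, rfl⟩ := hT.surjective x
      obtain ⟨v, rfl⟩ := hT.surjective y
      rw [hbr, htransport, htransport, map_sub]
    refine ⟨transport μ, transport ρ, ?_, fun x y => ?_, fun x y => ?_, hsplit_mul, hsplit_br⟩
    · exact h.isHomPreF e.toAddEquiv (fun v => (hφ v).symm) (htransport μ) (htransport ρ)
        hsplit_mul hsplit_br (fun x y z => by simp) (fun x y z => by simp)
    · obtain ⟨v, rfl⟩ := hT.surjective y
      rw [htransport, ← hφ, ← hφ, htransport]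
      exact congrArg T (h.2.2.1 x v).symm
    · obtain ⟨v, rfl⟩ := hT.surjective y
      rw [htransport, ← hφ, ← hφ, htransport]
      exact congrArg T (h.1 x v).symm
end
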